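/- Let X be a finite-dimensional real normed space and let α = {α_x}_{x∈X} be a rigid motion of X. For each t ∈ [−1,1], define β_t : X → X by β_t(x) = α_x(t) − α_0(t). Then: (i) each β_t is a surjective linear isometry of X; and (ii) the map t ↦ β_t is continuous from [−1,1] into the bounded linear operators on X with the operator norm; in particular, since β_0 is the identity, every β_t lies in the identity component of the isometry group of X. -/

import Mathlib

/-- A distance-preserving self-map of a compact metric space is surjective. -/
theorem Isometry.surjective_of_compactSpace {K : Type*} [MetricSpace K] [CompactSpace K]
    {f : K → K} (hf : Isometry f) : Function.Surjective f := by
  intro y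
  by_contra hy
  have hclosed : IsClosed (Set.range f) := (isCompact_range hf.continuous).isClosed
  obtain ⟨ε, hε, hball⟩ := Metric.isOpen_iff.1 hclosed.isOpen_compl y hy
  have hfar : ∀ x, ε ≤ dist (f x) y := fun x => by
    by_contra! h
    exact hball h ⟨x, rfl⟩
  obtain ⟨a, -, φ, hφ, ha⟩ := isCompact_univ.tendsto_subseq (x := fun n => f^[n] y)
    fun _ => Set.mem_univ _
  obtain ⟨N, hN⟩ := Metric.cauchySeq_iff'.1 ha.cauchySeq ε hε
  have hlt := hN (N + 1) N.le_succ
  obtain ⟨k, hk⟩ := Nat.exists_eq_add_of_lt (hφ N.lt_succ_self)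
  have hiter : Isometry (f^[φ N]) := by
    generalize φ N = n
    induction n with
    | zero => exact isometry_id
    | succ n ih => exact ih.comp hf
  simp only [Function.comp_apply, Nat.succ_eq_add_one] at hlt hk
  rw [hk, add_assoc, Function.iterate_add_apply, hiter.dist_eq, Function.iterate_succ_apply'] at hlt
  exact (hfar _).not_gt hlt

/-- A distance-preserving self-map of a proper metric space with a fixed point is surjective. -/
theorem Isometry.surjective_of_properSpace {Y : Type*} [MetricSpace Y] [ProperSpace Y]
    {f : Y → Y} (hf : Isometry f) {p : Y} (hp : f p = p) : Function.Surjective f := by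
  intro y
  have hmaps : Set.MapsTo f (Metric.closedBall p (dist y p)) (Metric.closedBall p (dist y p)) := by
    intro x hx
    rw [Metric.mem_closedBall] at hx ⊢
    calc dist (f x) p = dist (f x) (f p) := by rw [hp]
      _ = dist x p := hf.dist_eq x p
      _ ≤ dist y p := hx
  have : CompactSpace (Metric.closedBall p (dist y p)) :=
    isCompact_iff_compactSpace.1 (isCompact_closedBall p (dist y p))
  have hres : Isometry (hmaps.restrict f _ _) := fun a b => hf a b
  obtain ⟨x, hx⟩ := hres.surjective_of_compactSpace ⟨y, Metric.mem_closedBall.2 le_rfl⟩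
  exact ⟨x, congrArg Subtype.val hx⟩

/-- A distance-preserving self-map of a finite-dimensional real normed space that fixes the origin
is a surjective linear isometry. -/
theorem Isometry.exists_linearIsometryEquiv {X : Type*} [NormedAddCommGroup X] [NormedSpace ℝ X]
    [FiniteDimensional ℝ X] {f : X → X} (hf : Isometry f) (hzero : f 0 = 0) :
    ∃ e : X ≃ₗᵢ[ℝ] X, ⇑e = f := by
  have : ProperSpace X := FiniteDimensional.proper ℝ X
  let g : X ≃ᵢ X :=
    ⟨Equiv.ofBijective f ⟨hf.injective, hf.surjective_of_properSpace hzero⟩, hf⟩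
  exact ⟨g.toRealLinearIsometryEquivOfMapZero hzero, rfl⟩


theorem stmt13 {X : Type*} [NormedAddCommGroup X] [NormedSpace ℝ X]
    [FiniteDimensional ℝ X]
    (α : X → ℝ → X)
    (hcont : ∀ x, ContinuousOn (α x) (Set.Icc (-1) 1))
    (h0 : ∀ x, α x 0 = x)
    (hiso : ∀ x y, ∀ t ∈ Set.Icc (-1 : ℝ) 1, ‖α x t - α y t‖ = ‖x - y‖) :
    -- (i) each β_t is a surjective linear isometry of X
    (∀ t ∈ Set.Icc (-1 : ℝ) 1,
        IsLinearMap ℝ (fun x => α x t - α 0 t) ∧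
        Function.Surjective (fun x => α x t - α 0 t) ∧
        ∀ x, ‖α x t - α 0 t‖ = ‖x‖) ∧
    -- (ii) t ↦ β_t is continuous into the bounded operators with the operator norm
    (∃ L : ℝ → X →L[ℝ] X,
        (∀ t ∈ Set.Icc (-1 : ℝ) 1, ∀ x, L t x = α x t - α 0 t) ∧
        ContinuousOn L (Set.Icc (-1) 1)) ∧
    -- in particular each β_t lies in the identity component of the isometry group of X
    (∀ t ∈ Set.Icc (-1 : ℝ) 1,
        ∀ h : (fun x => α x t - α 0 t) ∈
            {φ : X → X | Function.Surjective φ ∧ ∀ a b, ‖φ a - φ b‖ = ‖a - b‖},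
        (⟨fun x => α x t - α 0 t, h⟩ :
            {φ : X → X | Function.Surjective φ ∧ ∀ a b, ‖φ a - φ b‖ = ‖a - b‖}) ∈
          connectedComponent ⟨id, Function.surjective_id, fun a b => rfl⟩) := by
  classical
  have hequiv : ∀ t ∈ Set.Icc (-1 : ℝ) 1, ∃ e : X ≃ₗᵢ[ℝ] X, ⇑e = fun x => α x t - α 0 t := by
    intro t ht
    refine Isometry.exists_linearIsometryEquiv (Isometry.of_dist_eq fun x y => ?_) (sub_self _)
    rw [dist_sub_right, dist_eq_norm, dist_eq_norm, hiso x y t ht]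
  choose e he using hequiv
  have hβ : ∀ x, ContinuousOn (fun t => α x t - α 0 t) (Set.Icc (-1) 1) :=
    fun x => (hcont x).sub (hcont 0)
  refine ⟨fun t ht => ?_, ?_, fun t ht h => ?_⟩
  · rw [← he t ht]
    refine ⟨(e t ht).toLinearEquiv.toLinearMap.isLinear, (e t ht).surjective, fun x => ?_⟩
    simpa using hiso x 0 t ht
  · let L : ℝ → X →L[ℝ] X := fun t =>
      if ht : t ∈ Set.Icc (-1 : ℝ) 1 then (e t ht).toContinuousLinearEquiv else 0
    have hL : ∀ t ∈ Set.Icc (-1 : ℝ) 1, ∀ x, L t x = α x t - α 0 t := by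
      intro t ht x
      simp only [L, dif_pos ht]
      exact congrFun (he t ht) x
    exact ⟨L, hL, continuousOn_clm_apply.2 fun x => (hβ x).congr fun t ht => hL t ht x⟩
  · have hmem : ∀ s : Set.Icc (-1 : ℝ) 1, (fun x => α x s - α 0 s) ∈
        {φ : X → X | Function.Surjective φ ∧ ∀ a b, ‖φ a - φ b‖ = ‖a - b‖} := by
      intro s
      refine ⟨?_, fun a b => ?_⟩
      · rw [← he s s.2]
        exact (e s s.2).surjective
      · simpa using hiso a b s s.2
    let γ : Set.Icc (-1 : ℝ) 1 →
        {φ : X → X | Function.Surjective φ ∧ ∀ a b, ‖φ a - φ b‖ = ‖a - b‖} :=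
      fun s => ⟨fun x => α x s - α 0 s, hmem s⟩
    have hγ : Continuous γ :=
      (continuous_pi fun x => continuousOn_iff_continuous_domRestrict.1 (hβ x)).subtype_mk _
    have : PreconnectedSpace (Set.Icc (-1 : ℝ) 1) :=
      isPreconnected_iff_preconnectedSpace.1 isPreconnected_Icc
    refine (isPreconnected_range hγ).subset_connectedComponent ⟨⟨0, by norm_num⟩, ?_⟩ ⟨⟨t, ht⟩, rfl⟩
    ext x
    simp [γ, h0]
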